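/- arXiv:2509.07086 — 2 statements merged into one kernel-verified Lean document; each statement's English description precedes it below -/
import Mathlib

section
/- There exists a positive semidefinite matrix ρ indexed by Fin 4 × Fin 5 over ℂ such that ρ is PPT, SN(ρ) ≤ 3, and ¬(SN(ρ) ≤ 2); that is, in local dimensions 4 × 5 a PPT state of Schmidt number exactly 3 exists. -/
open Matrix Kronecker ComplexOrder

/-- The Schmidt rank of a vector `ψ ∈ ℂ^(Fin m × Fin n)`: the rank of the associated
`m × n` matrix with `(i,j)` entry `ψ (i,j)`. -/
noncomputable def schmidtRank {m n : ℕ} (ψ : Fin m × Fin n → ℂ) : ℕ :=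
  (Matrix.of fun i j => ψ (i, j) : Matrix (Fin m) (Fin n) ℂ).rank

/-- Rank-one outer product `v v*`. -/
def outer {d : Type*} (v : d → ℂ) : Matrix d d ℂ :=
  Matrix.of fun a b => v a * star (v b)

/-- `SNle ρ k` : the Schmidt number of `ρ` is at most `k`, i.e. `ρ` is a finite sum of
outer products of vectors of Schmidt rank at most `k`. -/
def SNle {m n : ℕ} (ρ : Matrix (Fin m × Fin n) (Fin m × Fin n) ℂ) (k : ℕ) : Prop :=
  ∃ (T : ℕ) (v : Fin T → (Fin m × Fin n → ℂ)),
    (∀ t, schmidtRank (v t) ≤ k) ∧ ρ = ∑ t, outer (v t)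

/-- Partial transpose on the second (B) subsystem. -/
def ptB {m n : ℕ} (ρ : Matrix (Fin m × Fin n) (Fin m × Fin n) ℂ) :
    Matrix (Fin m × Fin n) (Fin m × Fin n) ℂ :=
  Matrix.of fun p q => ρ (p.1, q.2) (q.1, p.2)

/-- Partial transpose on the first (A) subsystem. -/
def ptA {m n : ℕ} (ρ : Matrix (Fin m × Fin n) (Fin m × Fin n) ℂ) :
    Matrix (Fin m × Fin n) (Fin m × Fin n) ℂ :=
  Matrix.of fun p q => ρ (q.1, p.2) (p.1, q.2)



/-- Block label of each cell (8 = empty cell). -/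
def blk : Fin 4 → Fin 5 → ℕ :=
  ![![0, 1, 2, 8, 8], ![3, 0, 4, 5, 6], ![5, 2, 0, 4, 3], ![6, 5, 8, 3, 7]]

/-- Weight of each cell. -/
def wt : Fin 4 → Fin 5 → ℤ :=
  ![![6, 600, 24, 0, 0], ![24, 6, 12, 24, 24], ![12, 24, 24, 24, 6], ![24, 3, 0, 12, 600]]

/-- The eight range vectors. -/
def psi (t : Fin 8) (p : Fin 4 × Fin 5) : ℤ := if blk p.1 p.2 = t.val then wt p.1 p.2 else 0

def ea : Fin 12 → Fin 4 × Fin 5 :=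
  ![(0,1), (0,2), (1,2), (0,1), (1,4), (1,3), (2,3), (1,3), (1,0), (1,1), (2,1), (1,0)]
def eb : Fin 12 → Fin 4 × Fin 5 :=
  ![(1,0), (2,0), (2,1), (2,2), (2,0), (3,0), (3,4), (2,2), (2,3), (3,3), (3,0), (3,4)]
def ca : Fin 12 → ℤ := ![36, 18, 12, 576, 18, 16, 1, 16, 16, 6, 6, 1]
def cb : Fin 12 → ℤ := ![1, 8, 12, 1, 8, 18, 72, 18, 18, 12, 6, 576]

/-- Vectors certifying positivity of the partial transpose. -/
def phi (t : Fin 12) (p : Fin 4 × Fin 5) : ℤ :=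
  if p = ea t then ca t else if p = eb t then cb t else 0

/-- Left-over diagonal. -/
def dlt (p : Fin 4 × Fin 5) : ℤ := ∑ t, psi t p * psi t p - ∑ t, phi t p * phi t p

lemma dlt_nonneg : ∀ p, 0 ≤ dlt p := by decide +kernel

lemma pt_identity : ∀ p q : Fin 4 × Fin 5,
    ∑ t, psi t (p.1, q.2) * psi t (q.1, p.2)
      = ∑ t, phi t p * phi t q + (if p = q then dlt p else 0) := by decide +kernel

/-- The state. -/
noncomputable def rho : Matrix (Fin 4 × Fin 5) (Fin 4 × Fin 5) ℂ :=
  ∑ t, outer (fun p => (psi t p : ℂ))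

lemma rho_apply (p q : Fin 4 × Fin 5) : rho p q = ((∑ t, psi t p * psi t q : ℤ) : ℂ) := by
  simp [rho, outer, Matrix.sum_apply]

lemma outer_psd {d : Type*} [Fintype d] (v : d → ℂ) : (outer v).PosSemidef := by
  have : outer v = Matrix.vecMulVec v (star v) := by
    ext i j; simp [outer, Matrix.vecMulVec_apply]
  rw [this]; exact Matrix.posSemidef_vecMulVec_self_star v

lemma rho_psd : rho.PosSemidef :=
  Matrix.posSemidef_sum _ fun _ _ => outer_psd _

lemma rho_ppt : (ptB rho).PosSemidef := by
  have : ptB rho = ∑ t, outer (fun p => (phi t p : ℂ)) + Matrix.diagonal fun p => (dlt p : ℂ) := by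
    ext p q
    have h := congrArg (fun z : ℤ => (z : ℂ)) (pt_identity p q)
    simp only [ptB, Matrix.of_apply, rho_apply, h]
    by_cases hpq : p = q <;> simp [outer, Matrix.sum_apply, hpq]
  rw [this]
  refine (Matrix.posSemidef_sum _ fun _ _ => outer_psd _).add ?_
  refine Matrix.PosSemidef.diagonal fun p => ?_
  have := dlt_nonneg p
  simpa using (Int.cast_nonneg (R := ℂ) this)

lemma rank_le_three (M : Matrix (Fin 4) (Fin 5) ℂ) (i₀ : Fin 4) (h : ∀ j, M i₀ j = 0) :
    M.rank ≤ 3 := by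
  have hM : M = Matrix.diagonal (fun i => if i = i₀ then (0:ℂ) else 1) * M := by
    ext i j
    rw [Matrix.diagonal_mul]
    by_cases hi : i = i₀
    · subst hi; simp [h]
    · simp [hi]
  rw [hM]
  refine (Matrix.rank_mul_le_left _ _).trans ?_
  rw [Matrix.rank_diagonal]
  fin_cases i₀ <;> simp [Fintype.card_subtype] <;> decide

lemma psi_zero_row : ∀ t, ∃ i, ∀ j, psi t (i, j) = 0 := by decide +kernel

lemma rho_sn3 : SNle rho 3 := by
  refine ⟨8, fun t p => (psi t p : ℂ), fun t => ?_, rfl⟩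
  obtain ⟨i, hi⟩ := psi_zero_row t
  exact rank_le_three _ i fun j => by simp [hi]

lemma minor_zero (M : Matrix (Fin 4) (Fin 5) ℂ) (h : M.rank ≤ 2) (r : Fin 3 → Fin 4)
    (c : Fin 3 → Fin 5) : (M.submatrix r c).det = 0 := by
  by_contra hd
  have h1 : (M.submatrix r c).rank = 3 := by
    have := Matrix.rank_of_isUnit (M.submatrix r c)
      ((Matrix.isUnit_iff_isUnit_det _).2 (isUnit_iff_ne_zero.2 hd))
    simpa using this
  have h2 := Matrix.rank_submatrix_le M r c
  omega

lemma kernel_vec {T : ℕ} (v : Fin T → (Fin 4 × Fin 5 → ℂ)) (hv : rho = ∑ t, outer (v t))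
    (p q : Fin 4 × Fin 5) (x y : ℤ)
    (h : x * x * (∑ t, psi t p * psi t p) + x * y * (∑ t, psi t p * psi t q)
      + y * x * (∑ t, psi t q * psi t p) + y * y * (∑ t, psi t q * psi t q) = 0) (t : Fin T) :
    (x : ℂ) * v t p + y * v t q = 0 := by
  have key : ∑ t, ((x : ℂ) * v t p + y * v t q) * star ((x : ℂ) * v t p + y * v t q) = 0 := by
    have e : ∀ a b, ∑ t, v t a * star (v t b) = ((∑ t, psi t a * psi t b : ℤ) : ℂ) := by
      intro a b
      rw [← rho_apply, hv]; simp [outer, Matrix.sum_apply]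
    have h' := congrArg (fun z : ℤ => (z : ℂ)) h
    simp only [Int.cast_add, Int.cast_mul, Int.cast_zero, ← e] at h'
    rw [← h']
    simp only [Finset.mul_sum, ← Finset.sum_add_distrib]
    refine Finset.sum_congr rfl fun t _ => ?_
    simp only [star_add, star_mul', star_intCast]
    ring
  have key2 : ∑ t, ‖(x : ℂ) * v t p + y * v t q‖ ^ 2 = 0 := by
    have : ((∑ t, ‖(x : ℂ) * v t p + y * v t q‖ ^ 2 : ℝ) : ℂ) = 0 := by
      rw [← key]; push_cast
      refine Finset.sum_congr rfl fun t _ => ?_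
      exact (Complex.mul_conj' _).symm
    exact_mod_cast this
  have := (Finset.sum_eq_zero_iff_of_nonneg (fun i _ => by positivity)).1 key2 t (Finset.mem_univ _)
  simpa using this

lemma alg (a b c d e f g h : ℂ) (ha : a ≠ 0)
    (H : (!![a, b, c, 0, 0; 4*d, a, e, 8*f, g; 4*f, c, 4*a, 2*e, d; g, f, 0, 2*d, h] :
      Matrix (Fin 4) (Fin 5) ℂ).rank ≤ 2) : False := by
  have m1 := minor_zero _ H ![0,1,2] ![0,3,4]
  have m2 := minor_zero _ H ![0,2,3] ![0,2,3]
  have m3 := minor_zero _ H ![0,1,3] ![0,2,3]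
  have m4 := minor_zero _ H ![0,1,2] ![0,2,4]
  have m5 := minor_zero _ H ![0,1,3] ![0,1,3]
  have m6 := minor_zero _ H ![0,1,2] ![0,1,3]
  have m7 := minor_zero _ H ![0,1,2] ![0,1,2]
  rw [Matrix.det_fin_three] at m1 m2 m3 m4 m5 m6 m7
  simp at m1 m2 m3 m4 m5 m6 m7
  clear H
  have h1 : 4 * f * d = g * e := by
    have : a * (4 * f * d - g * e) = 0 := by linear_combination m1 / 2
    have := (mul_eq_zero.1 this).resolve_left ha
    linear_combination this
  have hd : d = 0 := by
    have : a ^ 2 * d = 0 := by linear_combination m2 / 8 + c * h1 / 4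
    simpa [ha] using this
  subst hd
  by_cases hg : g = 0
  · subst hg
    have hf : f = 0 := by
      have : a * f ^ 2 = 0 := by linear_combination - m5 / 8
      simpa [ha] using this
    subst hf
    have he : e = 0 := by
      have : a ^ 2 * e = 0 := by linear_combination m6 / 2
      simpa [ha] using this
    subst he
    have : a ^ 3 = 0 := by linear_combination m7 / 4
    exact ha (by simpa using this)
  · have he : e = 0 := by
      have : g * e = 0 := by linear_combination - h1
      simpa [hg] using this
    subst he
    have hfc : f * c = a ^ 2 := by
      have : g * (f * c - a ^ 2) = 0 := by linear_combination m4 / 4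
      have := (mul_eq_zero.1 this).resolve_left hg
      linear_combination this
    have : g * a ^ 2 = 0 := by linear_combination m3 / 8 - g * hfc
    simp [hg, ha] at this

lemma rho_not_sn2 : ¬ SNle rho 2 := by
  rintro ⟨T, v, hr, hv⟩
  have hex : ∃ t, v t (0, 0) ≠ 0 := by
    by_contra! hc
    have h1 := rho_apply (0, 0) (0, 0)
    rw [hv] at h1
    simp only [Matrix.sum_apply, outer, Matrix.of_apply, hc, zero_mul, Finset.sum_const_zero] at h1
    have h2 : (∑ t, psi t (0, 0) * psi t (0, 0)) = 36 := by decide +kernel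
    rw [h2] at h1
    norm_num at h1
  obtain ⟨t, ht⟩ := hex
  have K := fun p q x y h => kernel_vec v hv p q x y h t
  have k1 := K (0,0) (1,1) 1 (-1) (by decide +kernel)
  have k2 := K (0,0) (2,2) 4 (-1) (by decide +kernel)
  have k3 := K (0,2) (2,1) 1 (-1) (by decide +kernel)
  have k4 := K (2,4) (1,0) 4 (-1) (by decide +kernel)
  have k5 := K (2,4) (3,3) 2 (-1) (by decide +kernel)
  have k6 := K (1,2) (2,3) 2 (-1) (by decide +kernel)
  have k7 := K (3,1) (1,3) 8 (-1) (by decide +kernel)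
  have k8 := K (3,1) (2,0) 4 (-1) (by decide +kernel)
  have k9 := K (1,4) (3,0) 1 (-1) (by decide +kernel)
  have z1 := K (0,3) (0,3) 1 0 (by decide +kernel)
  have z2 := K (0,4) (0,4) 1 0 (by decide +kernel)
  have z3 := K (3,2) (3,2) 1 0 (by decide +kernel)
  refine alg (v t (0,0)) (v t (0,1)) (v t (0,2)) (v t (2,4)) (v t (1,2)) (v t (3,1)) (v t (1,4))
    (v t (3,4)) ht ?_
  have hM : (Matrix.of fun i j => v t (i, j) : Matrix (Fin 4) (Fin 5) ℂ) =
    !![v t (0,0), v t (0,1), v t (0,2), 0, 0;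
       4 * v t (2,4), v t (0,0), v t (1,2), 8 * v t (3,1), v t (1,4);
       4 * v t (3,1), v t (0,2), 4 * v t (0,0), 2 * v t (1,2), v t (2,4);
       v t (1,4), v t (3,1), 0, 2 * v t (2,4), v t (3,4)] := by
    push_cast at k1 k2 k3 k4 k5 k6 k7 k8 k9 z1 z2 z3
    ext i j
    fin_cases i <;> fin_cases j <;> simp <;> first
      | linear_combination -k1 | linear_combination -k2 | linear_combination -k3
      | linear_combination -k4 | linear_combination -k5 | linear_combination -k6
      | linear_combination -k7 | linear_combination -k8 | linear_combination -k9
      | linear_combination z1 | linear_combination z2 | linear_combination z3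
  rw [← hM]
  exact hr t

/-- In local dimensions 4 × 5 a PPT state of Schmidt number exactly 3 exists. -/
theorem exists_ppt_4x5_schmidt_number_three :
    ∃ ρ : Matrix (Fin 4 × Fin 5) (Fin 4 × Fin 5) ℂ,
      ρ.PosSemidef ∧ (ptB ρ).PosSemidef ∧ SNle ρ 3 ∧ ¬ SNle ρ 2 :=
  ⟨rho, rho_psd, rho_ppt, rho_sn3, rho_not_sn2⟩
end

section
/- Let k ≥ 2, m ≥ 2, n ≥ 1 and let W be a Hermitian matrix indexed by Fin m × Fin n over ℂ that is k-block-positive: ⟨ψ, W ψ⟩ ≥ 0 for every ψ ∈ ℂ^(Fin m × Fin n) with SR(ψ) ≤ k. Then there exist a Hermitian matrix W' indexed by Fin (m−1) × Fin n that is (k−1)-block-positive (⟨ψ', W' ψ'⟩ ≥ 0 for every ψ' with SR(ψ') ≤ k−1) and a positive semidefinite matrix M indexed by Fin m × Fin n such that W = ι(W') + M, where ι(W') denotes W' extended by zeros to all index pairs whose first component equals m−1. (Schur complements for k-positivity: peeling off a 1×n subspace lowers block-positivity by exactly one order.) -/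
open Matrix Kronecker ComplexOrder

open ComplexOrder

theorem aux_rank_add {m n : ℕ} (A B : Matrix (Fin m) (Fin n) ℂ) :
    (A + B).rank ≤ A.rank + B.rank := by
  unfold Matrix.rank
  rw [Matrix.mulVecLin_add]
  refine le_trans (Submodule.finrank_mono (t := LinearMap.range A.mulVecLin ⊔ LinearMap.range B.mulVecLin) ?_)
    (Submodule.finrank_add_le_finrank_add_finrank _ _)
  rintro _ ⟨x, rfl⟩
  exact Submodule.add_mem_sup ⟨x, rfl⟩ ⟨x, rfl⟩

theorem aux_factor {a b c : Type*} [Fintype a] [Fintype b] [Fintype c] [DecidableEq a]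
    [DecidableEq b] [DecidableEq c]
    (C : Matrix a b ℂ) (D : Matrix c b ℂ) (h : ∀ x, C *ᵥ x = 0 → D *ᵥ x = 0) :
    ∃ X : Matrix c a ℂ, X * C = D := by
  let f := Matrix.toLin' C
  let d := Matrix.toLin' D
  have hd : LinearMap.ker f ≤ LinearMap.ker d := by
    intro x hx
    simp only [LinearMap.mem_ker, f, d, Matrix.toLin'_apply] at *
    exact h x hx
  obtain ⟨g, hg⟩ := LinearMap.exists_leftInverse_of_injective ((LinearMap.ker f).liftQ f le_rfl)
    (Submodule.ker_liftQ_eq_bot _ _ _ le_rfl)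
  refine ⟨LinearMap.toMatrix' (((LinearMap.ker f).liftQ d hd) ∘ₗ g), ?_⟩
  apply Matrix.toLin'.injective
  rw [Matrix.toLin'_mul, Matrix.toLin'_toMatrix']
  ext1 x
  have := congrArg ((LinearMap.ker f).liftQ d hd)
    (LinearMap.congr_fun hg ((LinearMap.ker f).mkQ (Pi.single x 1)))
  ext y
  have h2 := congrFun this y
  simpa [f, d] using h2

/-- Put a vector in the last row. -/
def auxLast {m n : ℕ} (c : Fin n → ℂ) : Fin (m + 1) × Fin n → ℂ :=
  fun q => if q.1 = Fin.last m then c q.2 else 0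

theorem aux_rank_last {m n : ℕ} (c : Fin n → ℂ) : schmidtRank (auxLast (m := m) c) ≤ 1 := by
  unfold schmidtRank
  have : (Matrix.of fun i j => auxLast (m := m) c (i, j)) =
      vecMulVec (fun i => if i = Fin.last m then 1 else 0) c := by
    ext i j; simp [auxLast, vecMulVec_apply]
  rw [this]
  exact rank_vecMulVec_le _ _

theorem aux_rank_single {m n : ℕ} (p : Fin m × Fin n) :
    schmidtRank (Pi.single p (1 : ℂ)) ≤ 1 := by
  unfold schmidtRank
  have : (Matrix.of fun i j => (Pi.single p (1 : ℂ) : Fin m × Fin n → ℂ) (i, j)) =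
      vecMulVec (Pi.single p.1 1) (Pi.single p.2 1) := by
    ext i j
    obtain ⟨a, b⟩ := p
    simp only [Matrix.of_apply, vecMulVec_apply, Pi.single_apply, Prod.mk.injEq]
    by_cases h1 : i = a <;> by_cases h2 : j = b <;> simp [h1, h2]
  rw [this]
  exact rank_vecMulVec_le _ _

theorem aux_rank_add' {m n : ℕ} (u v : Fin m × Fin n → ℂ) :
    schmidtRank (u + v) ≤ schmidtRank u + schmidtRank v :=
  aux_rank_add _ _

theorem aux_rank_emb {m n : ℕ} (v : Fin m × Fin n → ℂ) :
    schmidtRank (fun q : Fin (m + 1) × Fin n =>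
      if h : (q.1 : ℕ) < m then v (⟨q.1, h⟩, q.2) else 0) ≤ schmidtRank v := by
  unfold schmidtRank
  have : (Matrix.of fun i j => (fun q : Fin (m + 1) × Fin n =>
      if h : (q.1 : ℕ) < m then v (⟨q.1, h⟩, q.2) else 0) (i, j)) =
      (Matrix.of fun (i : Fin (m + 1)) (k : Fin m) => if (i : ℕ) = k then (1 : ℂ) else 0) *
      Matrix.of fun i j => v (i, j) := by
    ext i j
    simp only [Matrix.of_apply, Matrix.mul_apply, ite_mul, one_mul, zero_mul]
    split_ifs with h
    · rw [Finset.sum_eq_single ⟨i, h⟩]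
      · simp
      · intro b _ hb
        rw [if_neg]
        intro h'
        exact hb (Fin.ext h'.symm)
      · simp
    · rw [Finset.sum_eq_zero]
      intro b _
      rw [if_neg]
      have := b.2
      omega
  rw [this]
  exact rank_mul_le_right _ _

theorem aux_mulVec_last {m n : ℕ} {a : Type*} (W : Matrix a (Fin (m + 1) × Fin n) ℂ)
    (c : Fin n → ℂ) :
    W *ᵥ auxLast c = (W.submatrix id (fun j => (Fin.last m, j))) *ᵥ c := by
  ext p
  simp [mulVec, dotProduct, Fintype.sum_prod_type, Fin.sum_univ_castSucc, auxLast]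

theorem aux_last_dot {m n : ℕ} (v : Fin (m + 1) × Fin n → ℂ) (c : Fin n → ℂ) :
    star (auxLast c) ⬝ᵥ v = star c ⬝ᵥ (fun j => v (Fin.last m, j)) := by
  simp [dotProduct, Fintype.sum_prod_type, Fin.sum_univ_castSucc, auxLast]

theorem aux_ker {m n k : ℕ} (hk : 2 ≤ k)
    (W : Matrix (Fin (m + 1) × Fin n) (Fin (m + 1) × Fin n) ℂ) (hW : W.IsHermitian)
    (hpos : ∀ ψ : Fin (m + 1) × Fin n → ℂ, schmidtRank ψ ≤ k → 0 ≤ star ψ ⬝ᵥ W.mulVec ψ)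
    (c : Fin n → ℂ)
    (hc : W.submatrix (fun j => (Fin.last m, j)) (fun j => (Fin.last m, j)) *ᵥ c = 0) :
    W.submatrix id (fun j => (Fin.last m, j)) *ᵥ c = 0 := by
  ext p
  by_contra hz
  simp only [Pi.zero_apply] at hz
  set z := (W.submatrix id (fun j => (Fin.last m, j)) *ᵥ c) p with hzdef
  have hzz : 0 < Complex.normSq z := Complex.normSq_pos.2 hz
  have key : ∀ r : ℝ, 0 ≤ W p p - 2 * r * Complex.normSq z := by
    intro r
    let s : ℂ := -(r : ℂ) * star z
    have hr : schmidtRank (Pi.single p 1 + auxLast (m := m) (s • c)) ≤ k :=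
      (aux_rank_add' _ _).trans
        ((add_le_add (aux_rank_single p) (aux_rank_last _)).trans hk)
    have h := hpos _ hr
    have h3 : star (Pi.single p (1 : ℂ)) = (Pi.single p (1 : ℂ) : Fin (m + 1) × Fin n → ℂ) := by
      ext q; simp [Pi.single_apply]
    have h1 : star (Pi.single p (1 : ℂ)) ⬝ᵥ W *ᵥ auxLast (s • c) = s * z := by
      rw [aux_mulVec_last, mulVec_smul, h3]
      simp [hzdef]
    have h2 : star (auxLast (s • c)) ⬝ᵥ W *ᵥ Pi.single p (1 : ℂ) = star (s * z) := by
      rw [← h1, star_dotProduct, star_mulVec, hW.eq, ← dotProduct_mulVec]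
    have h4 : star (auxLast (s • c)) ⬝ᵥ W *ᵥ auxLast (s • c) = 0 := by
      rw [aux_last_dot, aux_mulVec_last, mulVec_smul]
      have : (fun j => (s • (W.submatrix id (fun j => (Fin.last m, j)) *ᵥ c)) (Fin.last m, j))
        = s • (W.submatrix (fun j => (Fin.last m, j)) (fun j => (Fin.last m, j)) *ᵥ c) := rfl
      rw [this, hc]; simp
    have h5 : star (Pi.single p (1 : ℂ)) ⬝ᵥ W *ᵥ Pi.single p (1 : ℂ) = W p p := by
      rw [h3]; simp
    rw [star_add, mulVec_add, add_dotProduct, dotProduct_add, dotProduct_add, h1, h2, h4, h5] at h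
    convert h using 1
    have : (Complex.normSq z : ℂ) = z * star z := (Complex.mul_conj z).symm
    rw [this]
    simp [s]
    ring
  have := (Complex.le_def.1 (key (((W p p).re + 1) / (2 * Complex.normSq z)))).1
  have e : (W p p - 2 * ((((W p p).re + 1) / (2 * Complex.normSq z) : ℝ) : ℂ) * Complex.normSq z).re
      = (W p p).re - 2 * (((W p p).re + 1) / (2 * Complex.normSq z)) * Complex.normSq z := by
    rw [Complex.sub_re]
    congr 1
    norm_cast
  rw [e] at this
  simp only [Complex.zero_re] at this
  field_simp at this
  linarith

/-- Schur complements for `k`-positivity: peeling off a `1 × n` subspace from a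
`k`-block-positive Hermitian `W` yields a `(k-1)`-block-positive `W'` on
`Fin (m-1) × Fin n` and a PSD remainder `M` with `W = ι(W') + M`. -/
theorem schur_complement_peel_off {m n k : ℕ} (hm : 2 ≤ m) (hn : 1 ≤ n) (hk : 2 ≤ k)
    (W : Matrix (Fin m × Fin n) (Fin m × Fin n) ℂ) (hW : W.IsHermitian)
    (hpos : ∀ ψ : Fin m × Fin n → ℂ, schmidtRank ψ ≤ k → 0 ≤ star ψ ⬝ᵥ W.mulVec ψ) :
    ∃ (W' : Matrix (Fin (m - 1) × Fin n) (Fin (m - 1) × Fin n) ℂ)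
      (M : Matrix (Fin m × Fin n) (Fin m × Fin n) ℂ),
      W'.IsHermitian ∧
      (∀ ψ' : Fin (m - 1) × Fin n → ℂ, schmidtRank ψ' ≤ k - 1 →
        0 ≤ star ψ' ⬝ᵥ W'.mulVec ψ') ∧
      M.PosSemidef ∧
      W = (Matrix.of fun p q =>
        if hp : (p.1 : ℕ) < m - 1 then
          if hq : (q.1 : ℕ) < m - 1 then W' (⟨p.1, hp⟩, p.2) (⟨q.1, hq⟩, q.2) else 0
        else 0) + M := by
  obtain ⟨m, rfl⟩ : ∃ m', m = m' + 1 := ⟨m - 1, by omega⟩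
  let J : Fin n → Fin (m + 1) × Fin n := fun j => (Fin.last m, j)
  obtain ⟨X, hX⟩ := aux_factor (W.submatrix J J) (W.submatrix id J)
    (fun c hc => aux_ker hk W hW hpos c hc)
  have hC : (W.submatrix J J).PosSemidef := by
    refine PosSemidef.of_dotProduct_mulVec_nonneg (hW.submatrix _) fun c => ?_
    have h := hpos (auxLast c) ((aux_rank_last c).trans (by omega))
    rw [aux_last_dot, aux_mulVec_last] at h
    exact h
  let Y : Matrix (Fin (m + 1) × Fin n) (Fin n) ℂ :=
    Matrix.of fun p j => if p.1 = Fin.last m then (if p.2 = j then 1 else 0) else X p j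
  have hYJ : ∀ j l, Y (J j) l = (1 : Matrix (Fin n) (Fin n) ℂ) j l := by
    intro j l
    simp [Y, J, Matrix.one_apply]
  have hY : Y * W.submatrix J J = W.submatrix id J := by
    ext p j
    by_cases hp : p.1 = Fin.last m
    · have : p = J p.2 := Prod.ext hp rfl
      rw [this]
      simp only [Matrix.mul_apply, hYJ]
      rw [← Matrix.mul_apply, Matrix.one_mul]
      rfl
    · rw [← hX]
      simp [Matrix.mul_apply, Y, hp]
  let M := Y * W.submatrix J J * Yᴴ
  have hM : M.PosSemidef := hC.mul_mul_conjTranspose_same Y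
  have hMJ : ∀ p j, M p (J j) = W p (J j) := by
    intro p j
    simp only [M, hY]
    rw [Matrix.mul_apply]
    simp [Matrix.conjTranspose_apply, hYJ, Matrix.one_apply]
  have hMJ' : ∀ p j, M (J j) p = W (J j) p := by
    intro p j
    rw [← hM.isHermitian.apply, hMJ, hW.apply]
  have hlast : ∀ p : Fin (m + 1) × Fin n, ¬ (p.1 : ℕ) < m + 1 - 1 → p = J p.2 := by
    intro p hp
    refine Prod.ext (Fin.ext ?_) rfl
    have := p.1.2
    simp [J]
    omega
  let W' : Matrix (Fin m × Fin n) (Fin m × Fin n) ℂ :=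
    (W - M).submatrix (fun p => (p.1.castSucc, p.2)) (fun p => (p.1.castSucc, p.2))
  have hdec : W = (Matrix.of fun p q =>
        if hp : (p.1 : ℕ) < m + 1 - 1 then
          if hq : (q.1 : ℕ) < m + 1 - 1 then W' (⟨p.1, hp⟩, p.2) (⟨q.1, hq⟩, q.2) else 0
        else 0) + M := by
    ext p q
    rw [Matrix.add_apply, Matrix.of_apply]
    split_ifs with hp hq
    · simp [W']
    · rw [hlast q hq, hMJ, zero_add]
    · rw [hlast p hp, hMJ', zero_add]
  refine ⟨W', M, (hW.sub hM.isHermitian).submatrix _, ?_, hM, hdec⟩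
  intro ψ' hψ'
  let e : Fin (m + 1) × Fin n → ℂ := fun q : Fin (m + 1) × Fin n =>
      if h : (q.1 : ℕ) < m then ψ' (⟨q.1, h⟩, q.2) else 0
  let c := -(Yᴴ *ᵥ e)
  let ψ := e + auxLast c
  have hr : schmidtRank ψ ≤ k := by
    refine (aux_rank_add' _ _).trans ?_
    have h1 := aux_rank_emb ψ'
    have h2 := aux_rank_last (m := m) c
    have h3 : schmidtRank e ≤ schmidtRank ψ' := h1
    have h4 : schmidtRank ψ' ≤ k - 1 := hψ'
    omega
  have hYψ : Yᴴ *ᵥ ψ = 0 := by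
    have : Yᴴ.submatrix id (fun j => (Fin.last m, j)) = 1 := by
      ext i j
      have := hYJ j i
      simp only [J] at this
      simp [Matrix.conjTranspose_apply, this, Matrix.one_apply, eq_comm]
    simp only [ψ]
    rw [mulVec_add, aux_mulVec_last, this]
    simp [c]
  have h := hpos ψ hr
  have hMψ : M *ᵥ ψ = 0 := by
    simp only [M]
    rw [← mulVec_mulVec, hYψ, mulVec_zero]
  rw [hdec, add_mulVec, hMψ, add_zero] at h
  have h0 : ∀ i j, ψ (Fin.castSucc i, j) = ψ' (i, j) := by
    intro i j
    simp [ψ, e, auxLast, Fin.castSucc_ne_last]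
  convert h using 1
  simp [dotProduct, mulVec, Fintype.sum_prod_type, Fin.sum_univ_castSucc, h0]
end
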